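/- arXiv:1603.03874 — 2 statements merged into one kernel-verified Lean document; each statement's English description precedes it below -/
import Mathlib

section
/- Let C : [0,∞) → ℝ be a measurable, bounded, nonincreasing function with C̲₀ ≤ C(ξ) ≤ C₀ for all ξ ≥ 0, where C̲₀, C₀ are real constants. Then the mean value modification C̃ of C satisfies C̃(ξ) + ξ C̃′(ξ) ≥ 2C̲₀ − C₀ for all ξ > 0. -/
open MeasureTheory Real

/-- The mean value modification of a transaction costs function `C`:
`C̃(ξ) = ∫₀^∞ C(ξx) x e^{-x²/2} dx`. -/
noncomputable def tildeC (C : ℝ → ℝ) (ξ : ℝ) : ℝ :=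
  ∫ x in Set.Ioi (0:ℝ), C (ξ * x) * x * Real.exp (-x ^ 2 / 2)

theorem integral_Ioi_mul_exp_neg_sq_div_two :
    ∫ x in Set.Ioi (0:ℝ), x * Real.exp (-(1 / 2) * x ^ 2) = 1 := by
  have h := integral_mul_cexp_neg_mul_sq (b := ((1 / 2 : ℝ) : ℂ)) (by norm_num)
  rw [← Complex.ofReal_inj, ← integral_complex_ofReal]
  push_cast at h ⊢
  rw [h]
  norm_num

/-- Bounded measurable functions are integrable on the half-line against `x e^{-bx²}`. -/
theorem integrableOn_Ioi_mul_mul_exp_neg_mul_sq {f : ℝ → ℝ} (hf : Measurable f) {M b : ℝ}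
    (hM : ∀ x ≥ (0:ℝ), |f x| ≤ M) (hb : 0 < b) :
    IntegrableOn (fun x => f x * (x * Real.exp (-b * x ^ 2))) (Set.Ioi 0) := by
  refine (integrable_mul_exp_neg_mul_sq hb).integrableOn.bdd_mul (c := M)
    hf.aestronglyMeasurable ?_
  filter_upwards [ae_restrict_mem measurableSet_Ioi] with x hx
  exact hM x (le_of_lt hx)

theorem tildeC_eq (C : ℝ → ℝ) (ξ : ℝ) :
    tildeC C ξ = ∫ x in Set.Ioi (0:ℝ), C (ξ * x) * (x * Real.exp (-(1 / 2) * x ^ 2)) := by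
  unfold tildeC
  congr 1 with x
  rw [mul_assoc]
  ring_nf

/-- Rescaling the integration variable moves the dependence on `ξ` into the Gaussian weight. -/
theorem sq_mul_tildeC (C : ℝ → ℝ) {ξ : ℝ} (hξ : 0 < ξ) :
    ξ ^ 2 * tildeC C ξ =
      ∫ u in Set.Ioi (0:ℝ), C u * (u * Real.exp (-(1 / (2 * ξ ^ 2)) * u ^ 2)) := by
  have h := integral_comp_mul_left_Ioi
    (fun u => C u * (u * Real.exp (-(1 / (2 * ξ ^ 2)) * u ^ 2))) 0 hξ
  rw [mul_zero, smul_eq_mul, eq_inv_mul_iff_mul_eq₀ hξ.ne'] at h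
  rw [← h, tildeC_eq, pow_two, mul_assoc, ← integral_const_mul ξ]
  congr 2 with x
  have : -(1 / (2 * (ξ * ξ))) * (ξ * x) ^ 2 = -(1 / 2) * x ^ 2 := by field_simp
  rw [this]
  ring

theorem tildeC_sub_const {C : ℝ → ℝ} (hmeas : Measurable C) {M : ℝ}
    (hM : ∀ x ≥ (0:ℝ), |C x| ≤ M) (c : ℝ) {ξ : ℝ} (hξ : 0 < ξ) :
    tildeC (fun x => C x - c) ξ = tildeC C ξ - c := by
  have h1 : IntegrableOn (fun x => C (ξ * x) * (x * Real.exp (-(1 / 2) * x ^ 2)))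
      (Set.Ioi 0) :=
    integrableOn_Ioi_mul_mul_exp_neg_mul_sq (hmeas.comp (measurable_const_mul ξ))
      (fun x hx => hM _ (mul_nonneg hξ.le hx)) (by norm_num)
  have h2 : IntegrableOn (fun x : ℝ => c * (x * Real.exp (-(1 / 2) * x ^ 2))) (Set.Ioi 0) :=
    ((integrable_mul_exp_neg_mul_sq (by norm_num)).const_mul c).integrableOn
  simp only [tildeC_eq, sub_mul]
  rw [integral_sub h1 h2, integral_const_mul, integral_Ioi_mul_exp_neg_sq_div_two, mul_one]

theorem tildeC_nonneg {C : ℝ → ℝ} (hC : ∀ x ≥ (0:ℝ), 0 ≤ C x) {ξ : ℝ} (hξ : 0 < ξ) :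
    0 ≤ tildeC C ξ :=
  setIntegral_nonneg measurableSet_Ioi fun _ hx =>
    mul_nonneg (mul_nonneg (hC _ (mul_nonneg hξ.le (le_of_lt hx))) (le_of_lt hx)) (exp_pos _).le

theorem tildeC_nonpos {C : ℝ → ℝ} (hC : ∀ x ≥ (0:ℝ), C x ≤ 0) {ξ : ℝ} (hξ : 0 < ξ) :
    tildeC C ξ ≤ 0 :=
  setIntegral_nonpos measurableSet_Ioi fun _ hx =>
    mul_nonpos_of_nonpos_of_nonneg
      (mul_nonpos_of_nonpos_of_nonneg (hC _ (mul_nonneg hξ.le (le_of_lt hx))) (le_of_lt hx))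
      (exp_pos _).le

theorem monotoneOn_sq_mul_tildeC {C : ℝ → ℝ} (hmeas : Measurable C) {M : ℝ}
    (hM : ∀ x ≥ (0:ℝ), |C x| ≤ M) (hC : ∀ x ≥ (0:ℝ), 0 ≤ C x) :
    MonotoneOn (fun ξ => ξ ^ 2 * tildeC C ξ) (Set.Ioi 0) := by
  intro a ha b hb hab
  have ha' : 0 < a := ha
  have hb' : 0 < b := hb
  simp only [sq_mul_tildeC C ha', sq_mul_tildeC C hb']
  refine setIntegral_mono_on
    (integrableOn_Ioi_mul_mul_exp_neg_mul_sq hmeas hM (by positivity))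
    (integrableOn_Ioi_mul_mul_exp_neg_mul_sq hmeas hM (by positivity))
    measurableSet_Ioi fun u hu => ?_
  have hu' : (0:ℝ) ≤ u := le_of_lt hu
  have := hC u hu'
  gcongr

/-- For a measurable, bounded, nonincreasing transaction costs function
`C` with `C̲₀ ≤ C(ξ) ≤ C₀` for all `ξ ≥ 0`, the mean value modification satisfies
`C̃(ξ) + ξ C̃′(ξ) ≥ 2C̲₀ − C₀` for all `ξ > 0`. -/
theorem tildeC_add_mul_deriv_lower_bound (C : ℝ → ℝ) (hmeas : Measurable C)
    (hmono : AntitoneOn C (Set.Ici 0))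
    (Cl Cu : ℝ) (hbdd : ∀ ξ ≥ (0:ℝ), Cl ≤ C ξ ∧ C ξ ≤ Cu) :
    ∀ ξ > (0:ℝ), 2 * Cl - Cu ≤ tildeC C ξ + ξ * deriv (tildeC C) ξ := by
  intro ξ hξ
  have hM : ∀ x ≥ (0:ℝ), |C x| ≤ max |Cl| |Cu| := fun x hx =>
    abs_le_max_abs_abs (hbdd x hx).1 (hbdd x hx).2
  have hlower : Cl ≤ tildeC C ξ := by
    have := tildeC_nonneg (C := fun x => C x - Cl) (fun x hx => sub_nonneg.2 (hbdd x hx).1) hξ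
    rwa [tildeC_sub_const hmeas hM Cl hξ, sub_nonneg] at this
  have hupper : tildeC C ξ ≤ Cu := by
    have := tildeC_nonpos (C := fun x => C x - Cu) (fun x hx => sub_nonpos.2 (hbdd x hx).2) hξ
    rwa [tildeC_sub_const hmeas hM Cu hξ, sub_nonpos] at this
  by_cases hd : DifferentiableAt ℝ (tildeC C) ξ
  · have hmon : MonotoneOn (fun η => η ^ 2 * (tildeC C η - Cl)) (Set.Ioi 0) := by
      refine (monotoneOn_sq_mul_tildeC (C := fun x => C x - Cl) (M := Cu - Cl)
        (hmeas.sub_const Cl) (fun x hx => ?_) fun x hx => sub_nonneg.2 (hbdd x hx).1).congr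
        fun η hη => by simp only [tildeC_sub_const hmeas hM Cl hη]
      rw [abs_of_nonneg (sub_nonneg.2 (hbdd x hx).1)]
      exact sub_le_sub_right (hbdd x hx).2 Cl
    have hderiv : HasDerivAt (fun η => η ^ 2 * (tildeC C η - Cl))
        (2 * ξ * (tildeC C ξ - Cl) + ξ ^ 2 * deriv (tildeC C) ξ) ξ := by
      have h := (hasDerivAt_pow 2 ξ).fun_mul (hd.hasDerivAt.sub_const Cl)
      norm_num at h
      exact h
    have hnonneg := hmon.derivWithin_nonneg (x := ξ)
    rw [derivWithin_of_isOpen isOpen_Ioi hξ, hderiv.deriv] at hnonneg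
    have : 0 ≤ ξ * (2 * (tildeC C ξ - Cl) + ξ * deriv (tildeC C) ξ) := by linarith
    have := nonneg_of_mul_nonneg_right this hξ
    linarith
  · rw [deriv_zero_of_not_differentiableAt hd]
    linarith
end

section
/- Let C : [0,∞) → ℝ be a measurable, bounded, nonincreasing function with C̲₀ ≤ C(ξ) ≤ C₀ for all ξ ≥ 0, let σ > 0 and Δt > 0, and define the diffusion function β(H) = (σ²/2)(1 − √(2/π) · C̃(σ√Δt · H)/(σ√Δt)) · H for H ≥ 0, where C̃ is the mean value modification of C. Then for all H ≥ 0 the derivative of β satisfies (σ²/2)(1 − Le) ≤ β′(H) ≤ (σ²/2)(1 − 2·L̲e + Le), where Le = √(2/π) · C₀/(σ√Δt) and L̲e = √(2/π) · C̲₀/(σ√Δt). -/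
open MeasureTheory Real

lemma integrableOn_pow_mul_exp_neg_mul_sq {p : ℝ} (hp : 0 < p) (n : ℕ) :
    IntegrableOn (fun u : ℝ => u ^ n * exp (-p * u ^ 2)) (Set.Ioi 0) := by
  have h := integrableOn_rpow_mul_exp_neg_mul_sq hp (s := n)
    (by have := n.cast_nonneg (α := ℝ); linarith)
  simpa only [rpow_natCast] using h

lemma integral_mul_exp_neg_mul_sq_Ioi {p : ℝ} (hp : 0 < p) :
    ∫ u in Set.Ioi (0 : ℝ), u ^ 1 * exp (-p * u ^ 2) = 1 / (2 * p) := by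
  have h := integral_rpow_mul_exp_neg_mul_rpow (p := 2) (q := (1 : ℕ)) two_pos (by norm_num) hp
  simp only [rpow_natCast, rpow_two] at h
  rw [h]
  norm_num [rpow_neg_one]

lemma integral_pow_three_mul_exp_neg_mul_sq_Ioi {p : ℝ} (hp : 0 < p) :
    ∫ u in Set.Ioi (0 : ℝ), u ^ 3 * exp (-p * u ^ 2) = 1 / (2 * p ^ 2) := by
  have h := integral_rpow_mul_exp_neg_mul_rpow (p := 2) (q := (3 : ℕ)) two_pos (by norm_num) hp
  simp only [rpow_natCast, rpow_two] at h
  rw [h]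
  have h2 : p ^ (-2 : ℝ) = (p ^ 2)⁻¹ := by
    rw [rpow_neg hp.le, rpow_two]
  norm_num [h2]

section Bounded

variable {C : ℝ → ℝ} {Cl Cu : ℝ}

lemma integrableOn_bdd_mul (hmeas : Measurable C) (hbdd : ∀ ξ ≥ (0 : ℝ), Cl ≤ C ξ ∧ C ξ ≤ Cu)
    {w : ℝ → ℝ} (hw : IntegrableOn w (Set.Ioi 0)) :
    IntegrableOn (fun u => C u * w u) (Set.Ioi 0) := by
  refine Integrable.bdd_mul (c := max |Cl| |Cu|) hw hmeas.aestronglyMeasurable ?_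
  filter_upwards [ae_restrict_mem measurableSet_Ioi] with u hu
  exact abs_le_max_abs_abs (hbdd u (Set.mem_Ioi.1 hu).le).1 (hbdd u (Set.mem_Ioi.1 hu).le).2

lemma integral_bdd_mul_mem_Icc (hmeas : Measurable C)
    (hbdd : ∀ ξ ≥ (0 : ℝ), Cl ≤ C ξ ∧ C ξ ≤ Cu)
    {w : ℝ → ℝ} (hw : IntegrableOn w (Set.Ioi 0)) (hw0 : ∀ u > 0, 0 ≤ w u) :
    Cl * (∫ u in Set.Ioi 0, w u) ≤ ∫ u in Set.Ioi 0, C u * w u ∧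
      ∫ u in Set.Ioi 0, C u * w u ≤ Cu * ∫ u in Set.Ioi 0, w u := by
  have hC := integrableOn_bdd_mul hmeas hbdd hw
  rw [← integral_const_mul, ← integral_const_mul]
  exact ⟨setIntegral_mono_on (hw.const_mul Cl) hC measurableSet_Ioi fun u hu =>
      mul_le_mul_of_nonneg_right (hbdd u (Set.mem_Ioi.1 hu).le).1 (hw0 u hu),
    setIntegral_mono_on hC (hw.const_mul Cu) measurableSet_Ioi fun u hu =>
      mul_le_mul_of_nonneg_right (hbdd u (Set.mem_Ioi.1 hu).le).2 (hw0 u hu)⟩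

lemma hasDerivAt_integral_mul_exp_neg_mul_sq (hmeas : Measurable C)
    (hbdd : ∀ ξ ≥ (0 : ℝ), Cl ≤ C ξ ∧ C ξ ≤ Cu) {p : ℝ} (hp : 0 < p) :
    HasDerivAt (fun q => ∫ u in Set.Ioi (0 : ℝ), C u * (u ^ 1 * exp (-q * u ^ 2)))
      (-∫ u in Set.Ioi (0 : ℝ), C u * (u ^ 3 * exp (-p * u ^ 2))) p := by
  rw [← integral_neg]
  have hp2 : 0 < p / 2 := by positivity
  refine (hasDerivAt_integral_of_dominated_loc_of_deriv_le
    (F' := fun q u => -(C u * (u ^ 3 * exp (-q * u ^ 2))))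
    (bound := fun u => ‖C u * (u ^ 3 * exp (-(p / 2) * u ^ 2))‖)
    (Ioi_mem_nhds (half_lt_self hp)) ?_ ?_ ?_ ?_ ?_ ?_).2
  · exact Filter.Eventually.of_forall fun q =>
      (hmeas.mul (by fun_prop)).aestronglyMeasurable
  · exact integrableOn_bdd_mul hmeas hbdd (integrableOn_pow_mul_exp_neg_mul_sq hp 1)
  · exact (hmeas.mul (by fun_prop)).neg.aestronglyMeasurable
  · refine Filter.Eventually.of_forall fun u q hq => ?_
    have hq' : p / 2 < q := hq
    simp only [norm_neg, norm_mul, norm_eq_abs, abs_exp]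
    gcongr
  · exact (integrableOn_bdd_mul hmeas hbdd (integrableOn_pow_mul_exp_neg_mul_sq hp2 3)).norm
  · refine Filter.Eventually.of_forall fun u q _ => ?_
    have h := ((((hasDerivAt_id q).neg.mul_const (u ^ 2)).exp).const_mul (u ^ 1)).const_mul (C u)
    refine h.congr_deriv ?_
    simp only [Pi.neg_apply, id]
    ring

lemma tildeC_eq_integral_mul_exp_neg_mul_sq (C : ℝ → ℝ) {ξ : ℝ} (hξ : 0 < ξ) :
    tildeC C ξ = (ξ ^ 2)⁻¹ *
      ∫ u in Set.Ioi (0 : ℝ), C u * (u ^ 1 * exp (-(2 * ξ ^ 2)⁻¹ * u ^ 2)) := by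
  have h := integral_comp_mul_left_Ioi
    (fun u => C u * (u ^ 1 * exp (-(2 * ξ ^ 2)⁻¹ * u ^ 2))) 0 hξ
  rw [mul_zero, smul_eq_mul] at h
  have h2 : (ξ ^ 2)⁻¹ * ∫ u in Set.Ioi (0 : ℝ), C u * (u ^ 1 * exp (-(2 * ξ ^ 2)⁻¹ * u ^ 2)) =
      ξ⁻¹ * (ξ⁻¹ * ∫ u in Set.Ioi (0 : ℝ), C u * (u ^ 1 * exp (-(2 * ξ ^ 2)⁻¹ * u ^ 2))) := by
    ring
  rw [h2, ← h, ← integral_const_mul, tildeC]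
  congr 1 with x
  have hexp : -(2 * ξ ^ 2)⁻¹ * (ξ * x) ^ 2 = -x ^ 2 / 2 := by
    field_simp
  rw [hexp]
  field_simp

lemma tildeC_mem_Icc (hmeas : Measurable C)
    (hbdd : ∀ ξ ≥ (0 : ℝ), Cl ≤ C ξ ∧ C ξ ≤ Cu) {ξ : ℝ} (hξ : 0 < ξ) :
    tildeC C ξ ∈ Set.Icc Cl Cu := by
  have hp : 0 < (2 * ξ ^ 2)⁻¹ := by positivity
  have h := integral_bdd_mul_mem_Icc hmeas hbdd (integrableOn_pow_mul_exp_neg_mul_sq hp 1)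
    fun u hu => by positivity
  rw [integral_mul_exp_neg_mul_sq_Ioi hp] at h
  have e : 1 / (2 * (2 * ξ ^ 2)⁻¹) = ξ ^ 2 := by field_simp
  rw [e] at h
  have hξ2 : 0 < ξ ^ 2 := by positivity
  rw [tildeC_eq_integral_mul_exp_neg_mul_sq C hξ, inv_mul_eq_div]
  exact ⟨(le_div_iff₀ hξ2).2 h.1, (div_le_iff₀ hξ2).2 h.2⟩

/-- `u ↦ C u - C (1 / √p)` and `u ↦ p u² - 1` have opposite signs, and the latter has mean zero
for the weight `u e^{-p u²}`. -/
lemma mul_integral_pow_three_le (hmeas : Measurable C) (hmono : AntitoneOn C (Set.Ici 0))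
    (hbdd : ∀ ξ ≥ (0 : ℝ), Cl ≤ C ξ ∧ C ξ ≤ Cu) {p : ℝ} (hp : 0 < p) :
    p * ∫ u in Set.Ioi (0 : ℝ), C u * (u ^ 3 * exp (-p * u ^ 2)) ≤
      ∫ u in Set.Ioi (0 : ℝ), C u * (u ^ 1 * exp (-p * u ^ 2)) := by
  have i1 := integrableOn_pow_mul_exp_neg_mul_sq hp 1
  have i3 := integrableOn_pow_mul_exp_neg_mul_sq hp 3
  have j1 := integrableOn_bdd_mul hmeas hbdd i1
  have j3 := integrableOn_bdd_mul hmeas hbdd i3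
  set r := (√p)⁻¹ with hr
  have hr0 : 0 < r := by positivity
  have hpr : p * r ^ 2 = 1 := by
    rw [hr, inv_pow, sq_sqrt hp.le, mul_inv_cancel₀ hp.ne']
  have key : ∫ u in Set.Ioi (0 : ℝ), (p * (C u * (u ^ 3 * exp (-p * u ^ 2))) -
        C u * (u ^ 1 * exp (-p * u ^ 2))) ≤
      ∫ u in Set.Ioi (0 : ℝ), (C r * p * (u ^ 3 * exp (-p * u ^ 2)) -
        C r * (u ^ 1 * exp (-p * u ^ 2))) := by
    refine setIntegral_mono_on ((j3.const_mul p).sub j1) ((i3.const_mul _).sub (i1.const_mul _))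
      measurableSet_Ioi fun u hu => ?_
    have hu0 : 0 < u := hu
    have hsign : (C u - C r) * (p * u ^ 2 - 1) ≤ 0 := by
      rcases le_total u r with h | h
      · refine mul_nonpos_of_nonneg_of_nonpos (sub_nonneg.2 (hmono hu0.le hr0.le h)) ?_
        rw [← hpr, sub_nonpos]
        gcongr
      · refine mul_nonpos_of_nonpos_of_nonneg (sub_nonpos.2 (hmono hr0.le hu0.le h)) ?_
        rw [← hpr, sub_nonneg]
        gcongr
    have hw : 0 ≤ u * exp (-p * u ^ 2) := by positivity
    linarith [mul_nonpos_of_nonpos_of_nonneg hsign hw]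
  rw [integral_sub (j3.const_mul p) j1, integral_sub (i3.const_mul _) (i1.const_mul _),
    integral_const_mul, integral_const_mul, integral_const_mul,
    integral_mul_exp_neg_mul_sq_Ioi hp, integral_pow_three_mul_exp_neg_mul_sq_Ioi hp] at key
  have e : C r * p * (1 / (2 * p ^ 2)) - C r * (1 / (2 * p)) = 0 := by
    field_simp
    ring
  linarith

lemma exists_hasDerivAt_mul_tildeC (hmeas : Measurable C) (hmono : AntitoneOn C (Set.Ici 0))
    (hbdd : ∀ ξ ≥ (0 : ℝ), Cl ≤ C ξ ∧ C ξ ≤ Cu) {ξ : ℝ} (hξ : 0 < ξ) :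
    ∃ D ∈ Set.Icc (2 * Cl - Cu) Cu,
      HasDerivAt (fun x => x * tildeC C x) D ξ := by
  set p := (2 * ξ ^ 2)⁻¹ with hpdef
  have hp : 0 < p := by positivity
  have hT := tildeC_mem_Icc hmeas hbdd hξ
  have hTeq := tildeC_eq_integral_mul_exp_neg_mul_sq C hξ
  rw [← hpdef] at hTeq
  have hle := mul_integral_pow_three_le hmeas hmono hbdd hp
  have h3 := (integral_bdd_mul_mem_Icc hmeas hbdd (integrableOn_pow_mul_exp_neg_mul_sq hp 3)
    fun u hu => by positivity).1
  rw [integral_pow_three_mul_exp_neg_mul_sq_Ioi hp] at h3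
  have hI := hasDerivAt_integral_mul_exp_neg_mul_sq hmeas hbdd hp
  set I1 := ∫ u in Set.Ioi (0 : ℝ), C u * (u ^ 1 * exp (-p * u ^ 2)) with hI1
  set I3 := ∫ u in Set.Ioi (0 : ℝ), C u * (u ^ 3 * exp (-p * u ^ 2))
  have h2p : (ξ ^ 2)⁻¹ = 2 * p := by rw [hpdef]; field_simp
  rw [h2p] at hTeq
  have hDle : 4 * p ^ 2 * I3 - 2 * p * I1 ≤ tildeC C ξ := by
    rw [hTeq]
    nlinarith [mul_le_mul_of_nonneg_left hle hp.le]
  refine ⟨4 * p ^ 2 * I3 - 2 * p * I1, ⟨?_, hDle.trans hT.2⟩, ?_⟩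
  · have h3' := mul_le_mul_of_nonneg_left h3 (by positivity : 0 ≤ 4 * p ^ 2)
    have e : 4 * p ^ 2 * (Cl * (1 / (2 * p ^ 2))) = 2 * Cl := by field_simp; ring
    linarith [hT.2]
  · have hder : HasDerivAt (fun x : ℝ => (2 * x ^ 2)⁻¹) (-(ξ ^ 3)⁻¹) ξ := by
      have h := ((hasDerivAt_pow 2 ξ).const_mul 2).fun_inv (by positivity)
      refine h.congr_deriv ?_
      field_simp
      norm_num
    have h := (hasDerivAt_inv hξ.ne').fun_mul (HasDerivAt.comp ξ hI hder)
    refine (h.congr_deriv ?_).congr_of_eventuallyEq ?_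
    · simp only [Function.comp_apply, ← hpdef, ← hI1]
      rw [h2p]
      have e : ξ⁻¹ * (ξ ^ 3)⁻¹ = 4 * p ^ 2 := by
        rw [hpdef]; field_simp; norm_num
      linear_combination I3 * e
    · filter_upwards [Ioi_mem_nhds hξ] with x hx
      have hx0 : 0 < x := hx
      rw [tildeC_eq_integral_mul_exp_neg_mul_sq C hx0, Function.comp_apply]
      field_simp

lemma antitoneOn_tildeC (hmeas : Measurable C) (hmono : AntitoneOn C (Set.Ici 0))
    (hbdd : ∀ ξ ≥ (0 : ℝ), Cl ≤ C ξ ∧ C ξ ≤ Cu) : AntitoneOn (tildeC C) (Set.Ioi 0) := by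
  have hi : ∀ ξ : ℝ, 0 < ξ → IntegrableOn
      (fun x => C (ξ * x) * x * exp (-x ^ 2 / 2)) (Set.Ioi 0) := fun ξ hξ => by
    have h := integrableOn_bdd_mul (hmeas.comp (measurable_const_mul ξ))
      (fun x hx => hbdd (ξ * x) (mul_nonneg hξ.le hx))
      (integrableOn_pow_mul_exp_neg_mul_sq (p := 1 / 2) (by norm_num) 1)
    refine h.congr_fun (fun x _ => ?_) measurableSet_Ioi
    have e : -(1 / 2) * x ^ 2 = -x ^ 2 / 2 := by ring
    simp only [Function.comp_apply, e]
    ring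
  intro a ha b hb hab
  refine setIntegral_mono_on (hi b hb) (hi a ha) measurableSet_Ioi fun x hx => ?_
  have hx0 : 0 < x := hx
  have ha0 : 0 < a := ha
  have hb0 : 0 < b := hb
  have := hmono (mul_pos ha0 hx0).le (mul_pos hb0 hx0).le (by gcongr)
  gcongr

/-- The function `x ↦ x C̃(x)` has a one-sided derivative at every point of `[0,∞)`, with values
between `2 C̲₀ - C₀` and `C₀`. -/
lemma exists_hasDerivWithinAt_mul_tildeC (hmeas : Measurable C)
    (hmono : AntitoneOn C (Set.Ici 0))
    (hbdd : ∀ ξ ≥ (0 : ℝ), Cl ≤ C ξ ∧ C ξ ≤ Cu) {ξ : ℝ} (hξ : 0 ≤ ξ) :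
    ∃ D ∈ Set.Icc (2 * Cl - Cu) Cu,
      HasDerivWithinAt (fun x => x * tildeC C x) D (Set.Ici 0) ξ := by
  rcases hξ.eq_or_lt with rfl | hξ
  · have hb : BddAbove (tildeC C '' Set.Ioi 0) := by
      refine ⟨Cu, ?_⟩
      rintro _ ⟨x, hx, rfl⟩
      exact (tildeC_mem_Icc hmeas hbdd hx).2
    have hlim := (antitoneOn_tildeC hmeas hmono hbdd).tendsto_nhdsGT hb
    have hL := isClosed_Icc.mem_of_tendsto hlim (Filter.eventually_of_mem self_mem_nhdsWithin
      fun x hx => tildeC_mem_Icc hmeas hbdd hx)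
    refine ⟨_, ⟨?_, hL.2⟩, ?_⟩
    · linarith [hL.1, hL.2]
    · rw [hasDerivWithinAt_iff_tendsto_slope, Set.Ici_sdiff_left]
      refine hlim.congr' (Filter.eventually_of_mem self_mem_nhdsWithin fun x hx => ?_)
      have hx0 : x ≠ 0 := (Set.mem_Ioi.1 hx).ne'
      simp [slope_def_field, hx0]
  · obtain ⟨D, hD, h⟩ := exists_hasDerivAt_mul_tildeC hmeas hmono hbdd hξ
    exact ⟨D, hD, h.hasDerivWithinAt⟩

end Bounded

/-- For a measurable, bounded, nonincreasing transaction costs function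
`C` with `C̲₀ ≤ C ≤ C₀` on `[0,∞)`, `σ, Δt > 0`, and the diffusion function
`β(H) = (σ²/2)(1 − √(2/π)·C̃(σ√Δt·H)/(σ√Δt))·H` for `H ≥ 0`, the derivative of `β`
(one-sided at `H = 0`) satisfies `(σ²/2)(1 − Le) ≤ β′(H) ≤ (σ²/2)(1 − 2L̲e + Le)` for
all `H ≥ 0`, where `Le = √(2/π)·C₀/(σ√Δt)` and `L̲e = √(2/π)·C̲₀/(σ√Δt)`. -/
theorem beta_deriv_bounds (C : ℝ → ℝ) (hmeas : Measurable C)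
    (hmono : AntitoneOn C (Set.Ici 0))
    (Cl Cu : ℝ) (hbdd : ∀ ξ ≥ (0:ℝ), Cl ≤ C ξ ∧ C ξ ≤ Cu)
    (σ Δt : ℝ) (hσ : 0 < σ) (hΔt : 0 < Δt)
    (β : ℝ → ℝ)
    (hβ : ∀ H ≥ (0:ℝ), β H =
      σ ^ 2 / 2 * (1 - Real.sqrt (2 / π) * tildeC C (σ * Real.sqrt Δt * H) / (σ * Real.sqrt Δt)) * H)
    (Le Lel : ℝ)
    (hLe : Le = Real.sqrt (2 / π) * Cu / (σ * Real.sqrt Δt))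
    (hLel : Lel = Real.sqrt (2 / π) * Cl / (σ * Real.sqrt Δt)) :
    ∀ H ≥ (0:ℝ),
      σ ^ 2 / 2 * (1 - Le) ≤ derivWithin β (Set.Ici 0) H ∧
      derivWithin β (Set.Ici 0) H ≤ σ ^ 2 / 2 * (1 - 2 * Lel + Le) := by
  intro H hH
  set a := σ * √Δt with ha
  have ha0 : 0 < a := by positivity
  obtain ⟨D, hD, hder⟩ :=
    exists_hasDerivWithinAt_mul_tildeC hmeas hmono hbdd (mul_nonneg ha0.le hH)
  set s := √(2 / π) / a with hs
  have hs0 : 0 ≤ s := by positivity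
  have hscale : HasDerivWithinAt (fun x : ℝ => a * x) a (Set.Ici 0) H := by
    simpa using (hasDerivWithinAt_id H (Set.Ici 0)).const_mul a
  have hcomp := HasDerivWithinAt.comp H hder hscale
    (fun x (hx : 0 ≤ x) => mul_nonneg ha0.le hx)
  have hβ' : HasDerivWithinAt β (σ ^ 2 / 2 * (1 - s * D)) (Set.Ici 0) H := by
    have h := ((hasDerivWithinAt_id H (Set.Ici 0)).fun_sub
      (hcomp.const_mul (s / a))).const_mul (σ ^ 2 / 2)
    have heq : ∀ x ∈ Set.Ici (0 : ℝ), β x = σ ^ 2 / 2 *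
        (id x - s / a * ((fun x => x * tildeC C x) ∘ fun x => a * x) x) := fun x hx => by
      rw [hβ x hx, hs]
      simp only [Function.comp_apply, id]
      field_simp
    refine (h.congr_deriv ?_).congr heq (heq H hH)
    field_simp
  rw [hβ'.derivWithin (uniqueDiffOn_Ici 0 H hH), hLe, hLel]
  have e : ∀ c, √(2 / π) * c / a = s * c := fun c => by rw [hs]; ring
  rw [e, e]
  constructor
  · gcongr
    exact hD.2
  · gcongr
    linarith [mul_le_mul_of_nonneg_left hD.1 hs0]
end
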